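/- Let τ ∈ (0,1), ν > -1/2 and N ≥ 1 be an integer. Define g_N(w) := ∑_{j=0}^{N-1} ((2j−1)!!·τ^{2j}/(2^j·Γ(j+ν+1)))·L_{2j}^{(2ν)}(2N·w/τ) for w ∈ ℂ. Then for all w ∈ ℂ: ((1−τ²)/(2N))·w·g_N''(w) + ( (1−τ²)(2ν+1)/(2N) + 2τ·w )·g_N'(w) − 2N·( w − τ·(2ν+1)/(2N) )·g_N(w) = ( (2N−1)!!·τ^{2N−1}/(2^{N−1}·Γ(N+ν)) )·L_{2N−1}^{(2ν)}(2N·w/τ). -/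

import Mathlib

open MeasureTheory

/-- Generalized Laguerre polynomial `L_j^{(ν)}(z)`. -/
noncomputable def laguerre (ν : ℝ) (j : ℕ) (z : ℂ) : ℂ :=
  ∑ k ∈ Finset.range (j + 1),
    ((Real.Gamma ((j : ℝ) + ν + 1) /
        (((j - k).factorial : ℝ) * Real.Gamma (ν + (k : ℝ) + 1)) : ℝ) : ℂ) *
      (-z) ^ k / ((k.factorial : ℝ) : ℂ)

/-- `g_N(w) = ∑_{j<N} ((2j-1)!! τ^{2j}/(2^j Γ(j+ν+1))) L_{2j}^{(2ν)}(2Nw/τ)`. -/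
noncomputable def gN (τ ν : ℝ) (N : ℕ) (w : ℂ) : ℂ :=
  ∑ j ∈ Finset.range N,
    (((((2 * j).factorial : ℝ) / ((2 : ℝ) ^ j * (j.factorial : ℝ))) * τ ^ (2 * j) /
        ((2 : ℝ) ^ j * Real.Gamma ((j : ℝ) + ν + 1)) : ℝ) : ℂ) *
      laguerre (2 * ν) (2 * j) (2 * (N : ℂ) * w / (τ : ℂ))

open Polynomial in
/-- The generalized Laguerre polynomial `L_n^{(a)}` as an element of `ℝ[X]`. -/
noncomputable def laguerrePoly (a : ℝ) (n : ℕ) : ℝ[X] :=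
  ∑ k ∈ Finset.range (n + 1),
    C (Real.Gamma (n + a + 1) / (n.factorial * Real.Gamma (a + k + 1)) * (-1) ^ k * n.choose k) *
      X ^ k

/-- The weights `(2j-1)!! τ^{2j} / (2^j Γ(j+ν+1))` in the definition of `gN`. -/
noncomputable def gNWeight (τ ν : ℝ) (j : ℕ) : ℝ :=
  ((2 * j).factorial / (2 ^ j * j.factorial)) * τ ^ (2 * j) / (2 ^ j * Real.Gamma (j + ν + 1))

open Polynomial in
/-- The polynomial `G` with `gN τ ν N w = G (2 N w / τ)`. -/
noncomputable def gNPoly (τ ν : ℝ) (N : ℕ) : ℝ[X] :=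
  ∑ j ∈ Finset.range N, C (gNWeight τ ν j) * laguerrePoly (2 * ν) (2 * j)

namespace laguerrePoly

open Polynomial

theorem coeff_eq (a : ℝ) (n k : ℕ) :
    (laguerrePoly a n).coeff k =
      Real.Gamma (n + a + 1) / (n.factorial * Real.Gamma (a + k + 1)) * (-1) ^ k * n.choose k := by
  simp only [laguerrePoly, finsetSum_coeff, coeff_C_mul, coeff_X_pow, mul_ite, mul_one, mul_zero,
    Finset.sum_ite_eq, Finset.mem_range]
  split_ifs with h
  · rfl
  · rw [Nat.choose_eq_zero_of_lt (by omega)]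
    simp

theorem laguerre_eq_aeval (a : ℝ) (n : ℕ) (z : ℂ) :
    laguerre a n z = aeval z (laguerrePoly a n) := by
  simp only [laguerre, laguerrePoly, map_sum, map_mul, aeval_C, map_pow, aeval_X]
  refine Finset.sum_congr rfl fun k hk => ?_
  have hk : k ≤ n := Nat.lt_succ_iff.mp (Finset.mem_range.mp hk)
  rw [neg_pow, Nat.cast_choose ℝ hk, Complex.coe_algebraMap]
  have h1 : (n.factorial : ℂ) ≠ 0 := by exact_mod_cast n.factorial_ne_zero
  have h2 : (k.factorial : ℂ) ≠ 0 := by exact_mod_cast k.factorial_ne_zero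
  have h3 : ((n - k).factorial : ℂ) ≠ 0 := by exact_mod_cast (n - k).factorial_ne_zero
  push_cast
  field_simp

theorem choose_succ_mul (n k : ℕ) :
    ((k : ℝ) + 1) * n.choose (k + 1) = (n - k) * n.choose k := by
  rcases le_or_gt k n with h | h
  · have := Nat.choose_succ_right_eq n k
    rw [← Nat.cast_sub h]
    exact_mod_cast (by linarith)
  · simp [Nat.choose_eq_zero_of_lt h, Nat.choose_eq_zero_of_lt (h.trans (Nat.lt_succ_self k))]

theorem Gamma_shift {a : ℝ} (ha : -1 < a) (k : ℕ) :
    Real.Gamma (a + k + 2) = (a + k + 1) * Real.Gamma (a + k + 1) := by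
  have hk : (0 : ℝ) ≤ k := k.cast_nonneg
  rw [← Real.Gamma_add_one (by linarith)]
  ring_nf

/-- Lowering relation, taking `L_{n+1}` to `-(n+1+a) L_n`. -/
theorem lowering {a : ℝ} (ha : -1 < a) (n : ℕ) :
    X * derivative (derivative (laguerrePoly a (n + 1))) +
        C (a + 1) * derivative (laguerrePoly a (n + 1)) =
      -C (n + 1 + a) * laguerrePoly a n := by
  have key (k : ℕ) : ((k : ℝ) + 1) * (a + k + 1) * (laguerrePoly a (n + 1)).coeff (k + 1) =
      -(n + 1 + a) * (laguerrePoly a n).coeff k := by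
    have hk : 0 < a + k + 1 := by linarith [k.cast_nonneg (α := ℝ)]
    have hG : 0 < Real.Gamma (a + k + 1) := Real.Gamma_pos_of_pos hk
    have hn : (n.factorial : ℝ) ≠ 0 := by exact_mod_cast n.factorial_ne_zero
    have hc : ((k : ℝ) + 1) * (n + 1).choose (k + 1) = (n + 1) * n.choose k := by
      have := Nat.add_one_mul_choose_eq n k
      exact_mod_cast (by linarith)
    have h1 : Real.Gamma (((n + 1 : ℕ) : ℝ) + a + 1) = (a + n + 1) * Real.Gamma (n + a + 1) := by
      rw [show (n : ℝ) + a + 1 = a + n + 1 by ring, ← Gamma_shift ha]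
      push_cast
      ring_nf
    have h2 : Real.Gamma (a + ((k + 1 : ℕ) : ℝ) + 1) = (a + k + 1) * Real.Gamma (a + k + 1) := by
      rw [← Gamma_shift ha]
      push_cast
      ring_nf
    rw [coeff_eq, coeff_eq, h1, h2, Nat.factorial_succ, pow_succ]
    push_cast
    field_simp
    linear_combination -(a + n + 1) * Real.Gamma (n + a + 1) * hc
  ext k
  have := key k
  rcases k with _ | k
  · simp [mul_coeff_zero, coeff_derivative] at this ⊢
    linear_combination this
  · rw [← C_neg]
    simp only [coeff_add, coeff_X_mul, coeff_C_mul, coeff_derivative] at this ⊢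
    push_cast at this ⊢
    linear_combination this

/-- Raising relation, taking `L_n` to `-(n+1) L_{n+1}`. -/
theorem raising {a : ℝ} (ha : -1 < a) (n : ℕ) :
    X * derivative (derivative (laguerrePoly a n)) + C (a + 1) * derivative (laguerrePoly a n) -
        2 * (X * derivative (laguerrePoly a n)) + X * laguerrePoly a n -
        C (a + 1) * laguerrePoly a n =
      -C (n + 1 : ℝ) * laguerrePoly a (n + 1) := by
  have hn : (n.factorial : ℝ) ≠ 0 := by exact_mod_cast n.factorial_ne_zero
  have h1 : Real.Gamma (((n + 1 : ℕ) : ℝ) + a + 1) = (a + n + 1) * Real.Gamma (n + a + 1) := by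
    rw [show (n : ℝ) + a + 1 = a + n + 1 by ring, ← Gamma_shift ha]
    push_cast
    ring_nf
  have h2 (k : ℕ) :
      Real.Gamma (a + ((k + 1 : ℕ) : ℝ) + 1) = (a + k + 1) * Real.Gamma (a + k + 1) := by
    rw [← Gamma_shift ha]
    push_cast
    ring_nf
  rw [← C_neg, show (2 : ℝ[X]) = C 2 from rfl]
  ext k
  rcases k with _ | k
  · have hG : 0 < Real.Gamma (a + 1) := Real.Gamma_pos_of_pos (by linarith)
    have h0 := h2 0
    have ha' : a + 1 ≠ 0 := by linarith
    simp only [coeff_add, coeff_sub, mul_coeff_zero, coeff_X_zero, coeff_derivative,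
      coeff_eq, h1, Nat.factorial_succ, h0]
    simp
    field_simp
    ring
  · have hk : 0 < a + k + 1 := by linarith [k.cast_nonneg (α := ℝ)]
    have hk' : 0 < a + (k + 1 : ℕ) + 1 := by push_cast; linarith
    have hG : 0 < Real.Gamma (a + k + 1) := Real.Gamma_pos_of_pos hk
    have hD := choose_succ_mul n k
    have hE := choose_succ_mul n (k + 1)
    simp only [coeff_add, coeff_sub, coeff_C_mul, coeff_X_mul, coeff_derivative, coeff_eq, h1, h2,
      Nat.factorial_succ, Nat.choose_succ_succ' n k, pow_succ]
    push_cast at hk' hE ⊢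
    field_simp
    linear_combination Real.Gamma (n + a + 1) * (k + a + 2) * (hE + hD)

/-- `L_0` is constant. -/
theorem derivative_zero (a : ℝ) : derivative (laguerrePoly a 0) = 0 := by
  simp [laguerrePoly]

end laguerrePoly

theorem gNWeight_succ (τ : ℝ) {ν : ℝ} (hν : -1 < ν) (j : ℕ) :
    2 * (j + 1 + ν) * gNWeight τ ν (j + 1) = (2 * j + 1) * τ ^ 2 * gNWeight τ ν j := by
  have hj : 0 < ν + j + 1 := by linarith [j.cast_nonneg (α := ℝ)]
  have hG : 0 < Real.Gamma (ν + j + 1) := Real.Gamma_pos_of_pos hj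
  have h1 : Real.Gamma (((j + 1 : ℕ) : ℝ) + ν + 1) = (ν + j + 1) * Real.Gamma (ν + j + 1) := by
    rw [← laguerrePoly.Gamma_shift hν]
    push_cast
    ring_nf
  have hf : (j.factorial : ℝ) ≠ 0 := by exact_mod_cast j.factorial_ne_zero
  rw [gNWeight, gNWeight, h1, show (j : ℝ) + ν + 1 = ν + j + 1 by ring,
    show 2 * (j + 1) = 2 * j + 1 + 1 by ring, Nat.factorial_succ, Nat.factorial_succ,
    Nat.factorial_succ]
  push_cast
  field_simp
  ring

open Polynomial in
/-- The differential equation for `gNPoly` in the rescaled variable. -/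
theorem gNPoly_differential_equation (τ : ℝ) {ν : ℝ} (hν : -(1 / 2 : ℝ) < ν) (N : ℕ) :
    C (1 - τ ^ 2) * (X * derivative (derivative (gNPoly τ ν (N + 1))) +
          C (2 * ν + 1) * derivative (gNPoly τ ν (N + 1))) +
        2 * C (τ ^ 2) * (X * derivative (gNPoly τ ν (N + 1))) -
        C (τ ^ 2) * ((X - C (2 * ν + 1)) * gNPoly τ ν (N + 1)) =
      C (2 * (N + 1 + ν) * gNWeight τ ν (N + 1)) * laguerrePoly (2 * ν) (2 * N + 1) := by
  have ha : -1 < 2 * ν := by linarith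
  induction N with
  | zero =>
    have hw := gNWeight_succ τ (ν := ν) (by linarith) 0
    have hr := laguerrePoly.raising ha 0
    have h0 := laguerrePoly.derivative_zero (2 * ν)
    rw [Nat.cast_zero] at hw ⊢
    rw [hw]
    simp only [gNPoly, zero_add, Finset.sum_range_one, mul_zero, derivative_C_mul, h0,
      derivative_zero, map_mul, map_one, one_mul, Nat.cast_zero] at hr ⊢
    linear_combination -C (τ ^ 2) * C (gNWeight τ ν 0) * hr
  | succ N ih =>
    have hw := congrArg C (gNWeight_succ τ (ν := ν) (by linarith) (N + 1))
    have hl := laguerrePoly.lowering ha (2 * N + 1)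
    have hr := laguerrePoly.raising ha (2 * (N + 1))
    have hs : gNPoly τ ν (N + 1 + 1) = gNPoly τ ν (N + 1) +
        C (gNWeight τ ν (N + 1)) * laguerrePoly (2 * ν) (2 * (N + 1)) :=
      Finset.sum_range_succ _ _
    rw [hs]
    rw [show 2 * N + 1 + 1 = 2 * (N + 1) by ring] at hl
    simp only [derivative_add, derivative_C_mul] at ih ⊢
    push_cast at hw hl hr ⊢
    simp only [map_add, map_sub, map_mul, map_one] at hw hl hr ih ⊢
    have h2 : (C 2 : ℝ[X]) = 2 := rfl
    simp only [h2] at hw hl hr ih ⊢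
    linear_combination ih + C (gNWeight τ ν (N + 1)) * hl -
      C (τ ^ 2) * C (gNWeight τ ν (N + 1)) * hr - hw * laguerrePoly (2 * ν) (2 * (N + 1) + 1)

theorem gN_eq_aeval (τ ν : ℝ) (N : ℕ) (w : ℂ) :
    gN τ ν N w = Polynomial.aeval (2 * (N : ℂ) / τ * w) (gNPoly τ ν N) := by
  simp only [gN, gNPoly, map_sum, map_mul, Polynomial.aeval_C]
  refine Finset.sum_congr rfl fun j _ => ?_
  rw [laguerrePoly.laguerre_eq_aeval, div_mul_eq_mul_div (2 * (N : ℂ))]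
  rfl

theorem deriv_aeval_const_mul (p : Polynomial ℝ) (c : ℂ) :
    deriv (fun w : ℂ => Polynomial.aeval (c * w) p) =
      fun w => c * Polynomial.aeval (c * w) (Polynomial.derivative p) := by
  funext w
  have h := (p.hasDerivAt_aeval (c * w)).comp w ((hasDerivAt_id w).const_mul c)
  simpa [Function.comp_def, mul_comm] using h.deriv

/-- Differential equation for the inhomogeneous term (Proposition 3.2). -/
theorem stmt_12 (τ ν : ℝ) (hτ : τ ∈ Set.Ioo (0 : ℝ) 1) (hν : -(1 / 2 : ℝ) < ν)
    (N : ℕ) (hN : 1 ≤ N) (w : ℂ) :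
    (((1 - τ ^ 2) / (2 * (N : ℝ)) : ℝ) : ℂ) * w * deriv (deriv (gN τ ν N)) w
      + ((((1 - τ ^ 2) * (2 * ν + 1) / (2 * (N : ℝ)) : ℝ) : ℂ) + 2 * (τ : ℂ) * w) *
          deriv (gN τ ν N) w
      - 2 * (N : ℂ) * (w - ((τ * (2 * ν + 1) / (2 * (N : ℝ)) : ℝ) : ℂ)) * gN τ ν N w
    = (((((2 * N).factorial : ℝ) / ((2 : ℝ) ^ N * (N.factorial : ℝ))) * τ ^ (2 * N - 1) /
          ((2 : ℝ) ^ (N - 1) * Real.Gamma ((N : ℝ) + ν)) : ℝ) : ℂ) *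
        laguerre (2 * ν) (2 * N - 1) (2 * (N : ℂ) * w / (τ : ℂ)) := by
  obtain ⟨M, rfl⟩ : ∃ M, N = M + 1 := ⟨N - 1, by omega⟩
  have hτ0 : (τ : ℂ) ≠ 0 := by exact_mod_cast hτ.1.ne'
  have hM : (M : ℂ) + 1 ≠ 0 := by exact_mod_cast M.succ_ne_zero
  set c : ℂ := 2 * ((M + 1 : ℕ) : ℂ) / τ with hc
  have hg : gN τ ν (M + 1) = fun w => Polynomial.aeval (c * w) (gNPoly τ ν (M + 1)) :=
    funext fun w => gN_eq_aeval τ ν (M + 1) w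
  have hd2 : deriv (deriv (gN τ ν (M + 1))) w = c * (c * Polynomial.aeval (c * w)
      (Polynomial.derivative (Polynomial.derivative (gNPoly τ ν (M + 1))))) := by
    rw [hg, deriv_aeval_const_mul, deriv_const_mul_field, deriv_aeval_const_mul]
  have hweight : (((2 * (M + 1)).factorial : ℝ) / ((2 : ℝ) ^ (M + 1) * ((M + 1).factorial : ℝ))) *
      τ ^ (2 * (M + 1) - 1) / ((2 : ℝ) ^ (M + 1 - 1) * Real.Gamma (((M + 1 : ℕ) : ℝ) + ν)) =
      2 * (M + 1 + ν) * gNWeight τ ν (M + 1) / τ := by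
    have hpos : 0 < (M : ℝ) + 1 + ν := by linarith [M.cast_nonneg (α := ℝ)]
    have hG : 0 < Real.Gamma ((M : ℝ) + 1 + ν) := Real.Gamma_pos_of_pos hpos
    have hτ' := hτ.1.ne'
    rw [gNWeight, Nat.add_sub_cancel, show 2 * (M + 1) - 1 = 2 * M + 1 by omega]
    push_cast
    rw [Real.Gamma_add_one hpos.ne']
    field_simp
    ring
  have key := congrArg (Polynomial.aeval (c * w)) (gNPoly_differential_equation τ hν M)
  rw [hweight, hd2, hg, deriv_aeval_const_mul, laguerrePoly.laguerre_eq_aeval,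
    show 2 * (M + 1) - 1 = 2 * M + 1 by omega,
    show 2 * ((M + 1 : ℕ) : ℂ) * w / τ = c * w by rw [hc, div_mul_eq_mul_div]]
  simp only [map_add, map_sub, map_mul, Polynomial.aeval_C, Polynomial.aeval_X, map_ofNat,
    Complex.coe_algebraMap] at key
  beta_reduce
  generalize Polynomial.aeval (c * w) (gNPoly τ ν (M + 1)) = G0 at key ⊢
  generalize Polynomial.aeval (c * w) (Polynomial.derivative (gNPoly τ ν (M + 1))) = G1 at key ⊢
  generalize Polynomial.aeval (c * w)
    (Polynomial.derivative (Polynomial.derivative (gNPoly τ ν (M + 1)))) = G2 at key ⊢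
  generalize Polynomial.aeval (c * w) (laguerrePoly (2 * ν) (2 * M + 1)) = L at key ⊢
  rw [hc] at key ⊢
  push_cast at key ⊢
  field_simp at key ⊢
  linear_combination key
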